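/- The map sending (a,b,c,d) to ‖(a,b,c,d)‖ is injective on the set T := {(a,b,c,d) ∈ ℤ_{≥0}⁴ : b ≤ 1, c ≤ q₀−1, d ≤ q₀−1}, and its image on T is exactly the set H. -/

import Mathlib

/-- The weighted value `‖(a,b,c,d)‖ = aq + b(q+q₀) + c(q+2q₀) + d(q+2q₀+1)`. -/
def suzukiNorm (q₀ q : ℕ) (x : ℕ × ℕ × ℕ × ℕ) : ℕ :=
  x.1 * q + x.2.1 * (q + q₀) + x.2.2.1 * (q + 2 * q₀) + x.2.2.2 * (q + 2 * q₀ + 1)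

theorem eq_and_eq_of_mul_add_eq {m x y r s : ℕ} (hr : r < m) (hs : s < m)
    (h : m * x + r = m * y + s) : x = y ∧ r = s := by
  have hm : r = s := by
    have := congrArg (· % m) h
    simpa [Nat.mul_add_mod, Nat.mod_eq_of_lt hr, Nat.mod_eq_of_lt hs] using this
  subst hm
  exact ⟨Nat.eq_of_mul_eq_mul_left (by omega) (Nat.add_right_cancel h), rfl⟩

theorem suzukiNorm_eq_nested (q₀ a b c d : ℕ) :
    suzukiNorm q₀ (2 * q₀ ^ 2) (a, b, c, d) =
      q₀ * (2 * (q₀ * (a + b + c + d) + c + d) + b) + d := by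
  simp only [suzukiNorm]
  ring

theorem suzukiNorm_injOn (q₀ : ℕ) (h₀ : 0 < q₀) :
    Set.InjOn (suzukiNorm q₀ (2 * q₀ ^ 2))
      {x : ℕ × ℕ × ℕ × ℕ | x.2.1 ≤ 1 ∧ x.2.2.1 ≤ q₀ - 1 ∧ x.2.2.2 ≤ q₀ - 1} := by
  rintro ⟨a, b, c, d⟩ ⟨hb, hc, hd⟩ ⟨a', b', c', d'⟩ ⟨hb', hc', hd'⟩ h
  dsimp only at hb hc hd hb' hc' hd'
  rw [suzukiNorm_eq_nested, suzukiNorm_eq_nested] at h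
  obtain ⟨h, rfl⟩ := eq_and_eq_of_mul_add_eq (by omega) (by omega) h
  obtain ⟨h, rfl⟩ := eq_and_eq_of_mul_add_eq (by omega) (by omega) h
  obtain ⟨h, rfl⟩ := eq_and_eq_of_mul_add_eq (by omega) (by omega) (Nat.add_right_cancel h)
  obtain rfl : a = a' := by omega
  rfl

theorem exists_reduced_suzukiNorm_eq (q₀ : ℕ) (h₀ : 2 ≤ q₀) (a b c d : ℕ) :
    ∃ x : ℕ × ℕ × ℕ × ℕ, (x.2.1 ≤ 1 ∧ x.2.2.1 ≤ q₀ - 1 ∧ x.2.2.2 ≤ q₀ - 1) ∧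
      suzukiNorm q₀ (2 * q₀ ^ 2) x = suzukiNorm q₀ (2 * q₀ ^ 2) (a, b, c, d) := by
  induction hk : b + c + d using Nat.strong_induction_on generalizing a b c d with
  | _ k ih =>
    by_cases hb : 2 ≤ b
    · obtain ⟨b, rfl⟩ := Nat.exists_eq_add_of_le hb
      obtain ⟨x, hx, h⟩ := ih _ (by omega) (a + 1) b (c + 1) d rfl
      refine ⟨x, hx, h.trans ?_⟩
      simp only [suzukiNorm]
      ring
    by_cases hc : q₀ ≤ c
    · obtain ⟨c, rfl⟩ := Nat.exists_eq_add_of_le hc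
      obtain ⟨x, hx, h⟩ := ih _ (by omega) (a + q₀ + 1) b c d rfl
      refine ⟨x, hx, h.trans ?_⟩
      simp only [suzukiNorm]
      ring
    by_cases hd : q₀ ≤ d
    · obtain ⟨d, rfl⟩ := Nat.exists_eq_add_of_le hd
      obtain ⟨x, hx, h⟩ := ih _ (by omega) (a + q₀) (b + 1) c d rfl
      refine ⟨x, hx, h.trans ?_⟩
      simp only [suzukiNorm]
      ring
    exact ⟨(a, b, c, d), ⟨by dsimp only; omega, by dsimp only; omega, by dsimp only; omega⟩, rfl⟩

theorem mem_closure_iff_exists_suzukiNorm (q₀ q m : ℕ) :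
    m ∈ AddSubmonoid.closure ({q, q + q₀, q + 2 * q₀, q + 2 * q₀ + 1} : Set ℕ) ↔
      ∃ x, suzukiNorm q₀ q x = m := by
  constructor
  · intro h
    induction h using AddSubmonoid.closure_induction with
    | mem y hy =>
      rcases hy with rfl | rfl | rfl | rfl
      · exact ⟨(1, 0, 0, 0), by simp [suzukiNorm]⟩
      · exact ⟨(0, 1, 0, 0), by simp [suzukiNorm]⟩
      · exact ⟨(0, 0, 1, 0), by simp [suzukiNorm]⟩
      · exact ⟨(0, 0, 0, 1), by simp [suzukiNorm]⟩
    | zero => exact ⟨0, by simp [suzukiNorm]⟩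
    | add y z _ _ hy hz =>
      obtain ⟨u, rfl⟩ := hy
      obtain ⟨v, rfl⟩ := hz
      refine ⟨u + v, ?_⟩
      simp only [suzukiNorm, Prod.fst_add, Prod.snd_add]
      ring
  · rintro ⟨⟨a, b, c, d⟩, rfl⟩
    simp only [suzukiNorm, ← smul_eq_mul]
    refine add_mem (add_mem (add_mem ?_ ?_) ?_) ?_ <;>
      exact AddSubmonoid.nsmul_mem _ (AddSubmonoid.subset_closure (by simp)) _

/-- the norm map is injective on
`T = {(a,b,c,d) : b ≤ 1, c ≤ q₀-1, d ≤ q₀-1}` and its image on `T` is the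
Weierstrass semigroup `H`. -/
theorem suzuki_norm_injOn_image (n : ℕ) (hn : 2 ≤ n) (q₀ q : ℕ) (hq₀ : q₀ = 2 ^ n)
    (hq : q = 2 * q₀ ^ 2) (H : AddSubmonoid ℕ)
    (hH : H = AddSubmonoid.closure {q, q + q₀, q + 2 * q₀, q + 2 * q₀ + 1}) :
    Set.InjOn (suzukiNorm q₀ q)
      {x : ℕ × ℕ × ℕ × ℕ | x.2.1 ≤ 1 ∧ x.2.2.1 ≤ q₀ - 1 ∧ x.2.2.2 ≤ q₀ - 1} ∧
    suzukiNorm q₀ q ''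
      {x : ℕ × ℕ × ℕ × ℕ | x.2.1 ≤ 1 ∧ x.2.2.1 ≤ q₀ - 1 ∧ x.2.2.2 ≤ q₀ - 1} =
      (H : Set ℕ) := by
  have h₀ : 2 ≤ q₀ := hq₀ ▸ Nat.le_self_pow (by omega) 2
  subst hq hH
  refine ⟨suzukiNorm_injOn q₀ (by omega), Set.ext fun m ↦ ?_⟩
  rw [SetLike.mem_coe, mem_closure_iff_exists_suzukiNorm]
  constructor
  · rintro ⟨x, -, hx⟩
    exact ⟨x, hx⟩
  · rintro ⟨⟨a, b, c, d⟩, rfl⟩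
    exact exists_reduced_suzukiNorm_eq q₀ h₀ a b c d
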